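/- Let 𝓓 = (Ω, 𝓑) be a supersimple 2-(n,4,λ) design with n > 4λ + 1, let ∞ ∈ Ω and G = π_∞(𝓓), and suppose G preserves a system of imprimitivity of Ω \ {∞} with ℓ blocks each of size k (so n − 1 = kℓ). Then at least one of the following holds: (i) whenever a, c ∈ Ω \ {∞} lie in the same block of imprimitivity, ∞ ∈ overline{a,c}; (ii) n ≤ 6ℓλ/(ℓ−1) + 1. -/

import Mathlib

open Equiv

variable {Ω : Type*} [DecidableEq Ω] [Fintype Ω]

/-- Two points of a 4-hypergraph are collinear if they are equal or some line contains both. -/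
def HGCollinear (B : Finset (Finset Ω)) (x y : Ω) : Prop :=
  x = y ∨ ∃ b ∈ B, x ∈ b ∧ y ∈ b

/-- A 4-hypergraph is pliable if any two lines sharing three pairwise distinct points are equal. -/
def HGPliable (B : Finset (Finset Ω)) : Prop :=
  ∀ b₁ ∈ B, ∀ b₂ ∈ B, ∀ p q r : Ω, p ≠ q → p ≠ r → q ≠ r →
    p ∈ b₁ → q ∈ b₁ → r ∈ b₁ → p ∈ b₂ → q ∈ b₂ → r ∈ b₂ → b₁ = b₂

/-- `g` is the elementary move `[x,y]`: it interchanges `x` and `y`, interchanges the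
remaining two points of every line through `x` and `y`, and fixes everything else.
For `x = y` it is the identity. -/
def IsElemMove (B : Finset (Finset Ω)) (x y : Ω) (g : Equiv.Perm Ω) : Prop :=
  (x = y ∧ g = 1) ∨
  (x ≠ y ∧ (∃ b ∈ B, x ∈ b ∧ y ∈ b) ∧ g x = y ∧ g y = x ∧
    ∀ z : Ω, z ≠ x → z ≠ y →
      ((∀ b ∈ B, ¬(x ∈ b ∧ y ∈ b ∧ z ∈ b)) → g z = z) ∧
      (∀ b ∈ B, x ∈ b → y ∈ b → z ∈ b →
        ∀ w ∈ b, w ≠ x → w ≠ y → w ≠ z → g z = w))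

/-- `g` is the move sequence `[a₀,…,a_k]` recorded by the list
(elementary moves applied left to right). -/
def IsMoveSeq (B : Finset (Finset Ω)) : List Ω → Equiv.Perm Ω → Prop
  | [], _ => False
  | [_], g => g = 1
  | a :: b :: l, g => ∃ e h : Equiv.Perm Ω,
      IsElemMove B a b e ∧ IsMoveSeq B (b :: l) h ∧ g = h * e

/-- The puzzle set `𝓛_𝓓` of all move sequences. -/
def puzzleSet (B : Finset (Finset Ω)) : Set (Equiv.Perm Ω) :=
  { g | ∃ l : List Ω, IsMoveSeq B l g }

/-- The hole stabiliser `π_x(𝓓)`: all closed move sequences starting and ending at `x`. -/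
def holeStab (B : Finset (Finset Ω)) (x : Ω) : Set (Equiv.Perm Ω) :=
  { g | ∃ l : List Ω, l.head? = some x ∧ l.getLast? = some x ∧ IsMoveSeq B l g }

/-- `(Ω, B)` is a 2-(n,4,λ) design: lines have four points and every pair of distinct
points lies in exactly `lam` lines. -/
def IsTwoDesign (B : Finset (Finset Ω)) (lam : ℕ) : Prop :=
  (∀ b ∈ B, b.card = 4) ∧
  ∀ p q : Ω, p ≠ q → (B.filter fun b => p ∈ b ∧ q ∈ b).card = lam

/-- Supersimple: any two distinct lines meet in at most two points. -/
def HGSupersimple (B : Finset (Finset Ω)) : Prop :=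
  ∀ b₁ ∈ B, ∀ b₂ ∈ B, b₁ ≠ b₂ → (b₁ ∩ b₂).card ≤ 2

/-- `x ∈ overline{a,c}`: `x` is `a`, `c`, or lies on a line containing both `a` and `c`. -/
def HGLineClosure (B : Finset (Finset Ω)) (a c x : Ω) : Prop :=
  x = a ∨ x = c ∨ ∃ b ∈ B, a ∈ b ∧ c ∈ b ∧ x ∈ b

/-- A system of imprimitivity for the hole stabiliser `π_x` acting on `Ω \ {x}`,
with `ℓ` blocks each of size `k`. -/
def IsHoleBlockSystem (B : Finset (Finset Ω)) (x : Ω) (P : Finset (Finset Ω))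
    (k ℓ : ℕ) : Prop :=
  P.card = ℓ ∧ 1 < k ∧ 1 < ℓ ∧ (∀ Δ ∈ P, Δ.card = k) ∧
  (∀ a : Ω, a ≠ x → ∃! Δ : Finset Ω, Δ ∈ P ∧ a ∈ Δ) ∧
  (∀ Δ ∈ P, x ∉ Δ) ∧
  (∀ g ∈ holeStab B x, ∀ Δ ∈ P, Δ.image (⇑g) ∈ P)

omit [Fintype Ω] in
/-- A supersimple hypergraph is pliable. -/
theorem HGSupersimple.pliable {B : Finset (Finset Ω)} (hss : HGSupersimple B) :
    HGPliable B := by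
  intro b₁ h₁ b₂ h₂ p q r hpq hpr hqr hp₁ hq₁ hr₁ hp₂ hq₂ hr₂
  by_contra hne
  have hsub : ({p, q, r} : Finset Ω) ⊆ b₁ ∩ b₂ := by
    intro z hz
    simp only [Finset.mem_insert, Finset.mem_singleton] at hz
    rcases hz with rfl | rfl | rfl <;> simp_all
  have hcard := Finset.card_le_card hsub
  rw [Finset.card_eq_three.mpr ⟨p, q, r, hpq, hpr, hqr, rfl⟩] at hcard
  have := hss b₁ h₁ b₂ h₂ hne
  omega

/-- The graph of the elementary move `[x,y]` for `x ≠ y`. -/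
def ElemMoveRel (B : Finset (Finset Ω)) (x y z w : Ω) : Prop :=
  (z = x ∧ w = y) ∨ (z = y ∧ w = x) ∨
  (z ≠ x ∧ z ≠ y ∧ w = z ∧ ∀ b ∈ B, ¬(x ∈ b ∧ y ∈ b ∧ z ∈ b)) ∨
  (z ≠ x ∧ z ≠ y ∧ w ≠ x ∧ w ≠ y ∧ w ≠ z ∧ ∃ b ∈ B, x ∈ b ∧ y ∈ b ∧ z ∈ b ∧ w ∈ b)

omit [Fintype Ω] in
theorem exists_fourth_point {b : Finset Ω} (hb : b.card = 4) (x y z : Ω) :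
    ∃ w ∈ b, w ≠ x ∧ w ≠ y ∧ w ≠ z := by
  have hlt : ({x, y, z} : Finset Ω).card < b.card := by
    have := Finset.card_le_three (a := x) (b := y) (c := z)
    omega
  obtain ⟨w, hw, hw'⟩ := Finset.exists_mem_notMem_of_card_lt_card hlt
  simp only [Finset.mem_insert, Finset.mem_singleton, not_or] at hw'
  exact ⟨w, hw, hw'⟩

omit [Fintype Ω] in
theorem fourth_point_unique {b : Finset Ω} (hb : b.card = 4) {x y z w w' : Ω} (hxy : x ≠ y)
    (hzx : z ≠ x) (hzy : z ≠ y) (hx : x ∈ b) (hy : y ∈ b) (hz : z ∈ b) (hw : w ∈ b)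
    (hw' : w' ∈ b) (hwx : w ≠ x) (hwy : w ≠ y) (hwz : w ≠ z)
    (hwx' : w' ≠ x) (hwy' : w' ≠ y) (hwz' : w' ≠ z) : w = w' := by
  by_contra hne
  have hsub : ({x, y, z, w, w'} : Finset Ω) ⊆ b := by
    intro t ht
    simp only [Finset.mem_insert, Finset.mem_singleton] at ht
    rcases ht with rfl | rfl | rfl | rfl | rfl <;> assumption
  have hcard := Finset.card_le_card hsub
  have h5 : ({x, y, z, w, w'} : Finset Ω).card = 5 := by
    rw [Finset.card_insert_of_notMem, Finset.card_insert_of_notMem,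
      Finset.card_insert_of_notMem, Finset.card_pair hne] <;>
    simp only [Finset.mem_insert, Finset.mem_singleton, not_or] <;> grind
  omega

omit [Fintype Ω] in
theorem ElemMoveRel.exists_right {B : Finset (Finset Ω)} (h4 : ∀ b ∈ B, b.card = 4)
    (x y z : Ω) : ∃ w, ElemMoveRel B x y z w := by
  by_cases hx : z = x
  · exact ⟨y, Or.inl ⟨hx, rfl⟩⟩
  by_cases hy : z = y
  · exact ⟨x, Or.inr (Or.inl ⟨hy, rfl⟩)⟩
  by_cases hl : ∃ b ∈ B, x ∈ b ∧ y ∈ b ∧ z ∈ b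
  · obtain ⟨b, hb, hxb, hyb, hzb⟩ := hl
    obtain ⟨w, hw, hwx, hwy, hwz⟩ := exists_fourth_point (h4 b hb) x y z
    exact ⟨w, Or.inr (Or.inr (Or.inr ⟨hx, hy, hwx, hwy, hwz, b, hb, hxb, hyb, hzb, hw⟩))⟩
  · exact ⟨z, Or.inr (Or.inr (Or.inl ⟨hx, hy, rfl, fun b hb h => hl ⟨b, hb, h⟩⟩))⟩

omit [DecidableEq Ω] [Fintype Ω] in
theorem ElemMoveRel.symm {B : Finset (Finset Ω)} {x y z w : Ω} (h : ElemMoveRel B x y z w) :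
    ElemMoveRel B x y w z := by
  rcases h with ⟨h, h'⟩ | ⟨h, h'⟩ | ⟨hx, hy, rfl, h⟩ |
    ⟨hx, hy, hwx, hwy, hwz, b, hb, hxb, hyb, hzb, hwb⟩
  · exact Or.inr (Or.inl ⟨h', h⟩)
  · exact Or.inl ⟨h', h⟩
  · exact Or.inr (Or.inr (Or.inl ⟨hx, hy, rfl, h⟩))
  · exact Or.inr (Or.inr (Or.inr ⟨hwx, hwy, hx, hy, hwz.symm, b, hb, hxb, hyb, hwb, hzb⟩))

omit [Fintype Ω] in
theorem ElemMoveRel.right_unique {B : Finset (Finset Ω)} (h4 : ∀ b ∈ B, b.card = 4)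
    (hpl : HGPliable B) {x y z w w' : Ω} (hxy : x ≠ y)
    (h : ElemMoveRel B x y z w) (h' : ElemMoveRel B x y z w') : w = w' := by
  rcases h with ⟨h1, h2⟩ | ⟨h1, h2⟩ | ⟨hx, hy, hw, h⟩ |
    ⟨hx, hy, hwx, hwy, hwz, b, hb, hxb, hyb, hzb, hwb⟩ <;>
  rcases h' with ⟨h1', h2'⟩ | ⟨h1', h2'⟩ | ⟨hx', hy', hw', h'⟩ |
    ⟨hx', hy', hwx', hwy', hwz', b', hb', hxb', hyb', hzb', hwb'⟩
  case inr.inr.inr.inr.inr.inr =>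
    obtain rfl := hpl b hb b' hb' x y z hxy hx.symm hy.symm hxb hyb hzb hxb' hyb' hzb'
    exact fourth_point_unique (h4 b hb) hxy hx hy hxb hyb hzb hwb hwb' hwx hwy hwz
      hwx' hwy' hwz'
  all_goals grind

omit [Fintype Ω] in
/-- Elementary moves exist for every pair of distinct collinear points. -/
theorem exists_isElemMove {B : Finset (Finset Ω)} (h4 : ∀ b ∈ B, b.card = 4)
    (hpl : HGPliable B) {x y : Ω} (hxy : x ≠ y) (hcol : ∃ b ∈ B, x ∈ b ∧ y ∈ b) :
    ∃ g, IsElemMove B x y g := by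
  choose f hf using ElemMoveRel.exists_right h4 x y
  have huniq : ∀ {z w}, ElemMoveRel B x y z w → f z = w := fun h =>
    ElemMoveRel.right_unique h4 hpl hxy (hf _) h
  have hinv : Function.Involutive f := fun z => huniq (hf z).symm
  refine ⟨hinv.toPerm, Or.inr ⟨hxy, hcol, huniq (Or.inl ⟨rfl, rfl⟩),
    huniq (Or.inr (Or.inl ⟨rfl, rfl⟩)), fun z hzx hzy => ⟨fun h => ?_, ?_⟩⟩⟩
  · exact huniq (Or.inr (Or.inr (Or.inl ⟨hzx, hzy, rfl, h⟩)))
  · intro b hb hx hy hz w hw hwx hwy hwz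
    exact huniq (Or.inr (Or.inr (Or.inr
      ⟨hzx, hzy, hwx, hwy, hwz, b, hb, hx, hy, hz, hw⟩)))

omit [DecidableEq Ω] [Fintype Ω] in
theorem IsElemMove.apply_left {B : Finset (Finset Ω)} {x y : Ω} {g : Equiv.Perm Ω}
    (h : IsElemMove B x y g) : g x = y := by
  rcases h with ⟨rfl, rfl⟩ | h
  · rfl
  · exact h.2.2.1

omit [DecidableEq Ω] [Fintype Ω] in
theorem IsElemMove.apply_right {B : Finset (Finset Ω)} {x y : Ω} {g : Equiv.Perm Ω}
    (h : IsElemMove B x y g) : g y = x := by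
  rcases h with ⟨rfl, rfl⟩ | h
  · rfl
  · exact h.2.2.2.1

omit [DecidableEq Ω] [Fintype Ω] in
theorem IsElemMove.apply_of_not_lineClosure {B : Finset (Finset Ω)} {x y z : Ω}
    {g : Equiv.Perm Ω} (h : IsElemMove B x y g) (hz : ¬ HGLineClosure B x y z) : g z = z := by
  rcases h with ⟨rfl, rfl⟩ | h
  · rfl
  · simp only [HGLineClosure, not_or, not_exists, not_and] at hz
    exact (h.2.2.2.2 z hz.1 hz.2.1).1 fun b hb hb' => hz.2.2 b hb hb'.1 hb'.2.1 hb'.2.2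

omit [Fintype Ω] in
theorem IsTwoDesign.collinear {B : Finset (Finset Ω)} {lam : ℕ} (hdes : IsTwoDesign B lam)
    (hlam : 0 < lam) {p q : Ω} (hpq : p ≠ q) : ∃ b ∈ B, p ∈ b ∧ q ∈ b := by
  have hpos := hlam
  rw [← hdes.2 p q hpq, Finset.card_pos] at hpos
  obtain ⟨b, hb⟩ := hpos
  exact ⟨b, (Finset.mem_filter.mp hb).1, (Finset.mem_filter.mp hb).2⟩

/-- The points other than `p` and `q` on the lines through `p` and `q`. -/
def lineRemainder (B : Finset (Finset Ω)) (p q : Ω) : Finset Ω :=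
  (B.filter fun b => p ∈ b ∧ q ∈ b).biUnion fun b => b \ {p, q}

omit [Fintype Ω] in
theorem IsTwoDesign.card_lineRemainder_le {B : Finset (Finset Ω)} {lam : ℕ}
    (hdes : IsTwoDesign B lam) {p q : Ω} (hpq : p ≠ q) :
    (lineRemainder B p q).card ≤ lam * 2 := by
  rw [← hdes.2 p q hpq]
  refine Finset.card_biUnion_le_card_mul _ _ _ fun b hb => ?_
  obtain ⟨hb, hp, hq⟩ := Finset.mem_filter.mp hb
  rw [Finset.card_sdiff_of_subset (by grind), hdes.1 b hb, Finset.card_pair hpq]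

omit [Fintype Ω] in
theorem mem_lineRemainder {B : Finset (Finset Ω)} {p q z : Ω} (hp : z ≠ p) (hq : z ≠ q)
    (hz : HGLineClosure B p q z) : z ∈ lineRemainder B p q := by
  obtain ⟨b, hb, hpb, hqb, hzb⟩ := (hz.resolve_left hp).resolve_left hq
  exact Finset.mem_biUnion.mpr ⟨b, by simp [hb, hpb, hqb], by simp [hzb, hp, hq]⟩

omit [Fintype Ω] in
/-- If `c` lies off the line closures of the pairs from `x, a, d`, and `x` off that of `a, d`,
then some closed move sequence at `x` sends `a` to `d` and fixes `c`. -/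
theorem exists_mem_holeStab {B : Finset (Finset Ω)} {lam : ℕ} (hlam : 0 < lam)
    (hdes : IsTwoDesign B lam) (hss : HGSupersimple B) {x a c d : Ω}
    (hax : a ≠ x) (hda : d ≠ a) (hdx : d ≠ x)
    (hxac : ¬ HGLineClosure B x a c) (hadx : ¬ HGLineClosure B a d x)
    (hadc : ¬ HGLineClosure B a d c) (hdxc : ¬ HGLineClosure B d x c) :
    ∃ g ∈ holeStab B x, g a = d ∧ g c = c := by
  obtain ⟨e₁, h₁⟩ := exists_isElemMove hdes.1 hss.pliable hax.symm
    (hdes.collinear hlam hax.symm)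
  obtain ⟨e₂, h₂⟩ := exists_isElemMove hdes.1 hss.pliable hda.symm
    (hdes.collinear hlam hda.symm)
  obtain ⟨e₃, h₃⟩ := exists_isElemMove hdes.1 hss.pliable hdx
    (hdes.collinear hlam hdx)
  refine ⟨e₃ * e₂ * e₁, ⟨[x, a, d, x], rfl, rfl, e₁, e₃ * e₂, h₁,
    ⟨e₂, e₃, h₂, ⟨e₃, 1, h₃, rfl, (one_mul _).symm⟩, rfl⟩, rfl⟩, ?_, ?_⟩
  · simp only [Equiv.Perm.mul_apply]
    rw [h₁.apply_right, h₂.apply_of_not_lineClosure hadx, h₃.apply_right]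
  · simp only [Equiv.Perm.mul_apply]
    rw [h₁.apply_of_not_lineClosure hxac, h₂.apply_of_not_lineClosure hadc,
      h₃.apply_of_not_lineClosure hdxc]

theorem IsHoleBlockSystem.mul_lt_card {B : Finset (Finset Ω)} {x : Ω}
    {P : Finset (Finset Ω)} {k ℓ : ℕ} (hP : IsHoleBlockSystem B x P k ℓ) :
    ℓ * k < Fintype.card Ω := by
  obtain ⟨hcard, -, -, hk, huniq, hx, -⟩ := hP
  have hdisj : (P : Set (Finset Ω)).PairwiseDisjoint id := by
    intro Δ hΔ Δ' hΔ' hne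
    refine Finset.disjoint_left.mpr fun a ha ha' => hne ?_
    exact (huniq a (fun h => hx Δ hΔ (h ▸ ha))).unique ⟨hΔ, ha⟩ ⟨hΔ', ha'⟩
  have hsum : (P.biUnion id).card = ℓ * k := by
    rw [Finset.card_biUnion hdisj, ← hcard]
    exact Finset.sum_const_nat hk
  rw [← hsum]
  refine Finset.card_lt_univ_of_notMem (x := x) fun h => ?_
  obtain ⟨Δ, hΔ, hxΔ⟩ := Finset.mem_biUnion.mp h
  exact hx Δ hΔ hxΔ

/-- If some block contains two points sharing no line with the hole `x`, then at most
`6 * lam + 1` points lie outside that block. -/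
theorem IsHoleBlockSystem.card_le {B : Finset (Finset Ω)} {lam : ℕ} (hlam : 0 < lam)
    (hdes : IsTwoDesign B lam) (hss : HGSupersimple B) {x : Ω} {P : Finset (Finset Ω)}
    {k ℓ : ℕ} (hP : IsHoleBlockSystem B x P k ℓ) {a c : Ω} (hax : a ≠ x) (hcx : c ≠ x)
    (hac : a ≠ c) {Δ : Finset Ω} (hΔ : Δ ∈ P) (ha : a ∈ Δ) (hc : c ∈ Δ)
    (hacx : ¬ HGLineClosure B a c x) : Fintype.card Ω ≤ 6 * lam + 1 + k := by
  obtain ⟨-, -, -, hk, huniq, -, hinv⟩ := hP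
  have hcover : Finset.univ ⊆ ({x} ∪ (lineRemainder B x a ∪ lineRemainder B a c ∪
      lineRemainder B x c)) ∪ Δ := by
    intro d _
    by_contra hd
    simp only [Finset.mem_union, Finset.mem_singleton, not_or] at hd
    obtain ⟨⟨hdx, ⟨hxa, hac'⟩, hxc⟩, hdΔ⟩ := hd
    have hda : d ≠ a := fun h => hdΔ (h ▸ ha)
    have hdc : d ≠ c := fun h => hdΔ (h ▸ hc)
    have hxa' := mt (mem_lineRemainder hdx hda) hxa
    have hac'' := mt (mem_lineRemainder hda hdc) hac'
    have hxc' := mt (mem_lineRemainder hdx hdc) hxc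
    simp only [HGLineClosure] at hxa' hac'' hxc' hacx
    obtain ⟨g, hg, hga, hgc⟩ := exists_mem_holeStab (c := c) hlam hdes hss hax hda hdx
      (by unfold HGLineClosure; grind) (by unfold HGLineClosure; grind)
      (by unfold HGLineClosure; grind) (by unfold HGLineClosure; grind)
    have himg : Δ.image g = Δ := (huniq c hcx).unique
      ⟨hinv g hg Δ hΔ, Finset.mem_image.mpr ⟨c, hc, hgc⟩⟩ ⟨hΔ, hc⟩
    exact hdΔ (himg ▸ Finset.mem_image.mpr ⟨a, ha, hga⟩)
  have h₀ := Finset.card_le_card hcover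
  rw [Finset.card_univ] at h₀
  have h₁ := Finset.card_union_le ({x} ∪ (lineRemainder B x a ∪ lineRemainder B a c ∪
      lineRemainder B x c)) Δ
  have h₂ := Finset.card_union_le {x} (lineRemainder B x a ∪ lineRemainder B a c ∪
      lineRemainder B x c)
  have h₃ := Finset.card_union_le (lineRemainder B x a ∪ lineRemainder B a c)
      (lineRemainder B x c)
  have h₄ := Finset.card_union_le (lineRemainder B x a) (lineRemainder B a c)
  have h₅ := hdes.card_lineRemainder_le hax.symm
  have h₆ := hdes.card_lineRemainder_le hac
  have h₇ := hdes.card_lineRemainder_le hcx.symm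
  rw [hk Δ hΔ] at h₁
  rw [Finset.card_singleton] at h₂
  omega

/-- (Lemma 5.2) If `n > 4λ + 1` and the hole stabilizer preserves a
system of imprimitivity with `ℓ` blocks of size `k`, then either points in a common
block satisfy `∞ ∈ overline{a,c}`, or `n ≤ 6ℓλ/(ℓ-1) + 1`
(equivalently `(n-1)(ℓ-1) ≤ 6ℓλ`). -/
theorem stmt8 (B : Finset (Finset Ω)) (n lam : ℕ) (hn : Fintype.card Ω = n)
    (hlam : 0 < lam) (hdes : IsTwoDesign B lam) (hss : HGSupersimple B)
    (hbig : 4 * lam + 1 < n) (x : Ω)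
    (P : Finset (Finset Ω)) (k ℓ : ℕ) (hP : IsHoleBlockSystem B x P k ℓ) :
    (∀ a c : Ω, a ≠ x → c ≠ x → a ≠ c →
        (∃ Δ ∈ P, a ∈ Δ ∧ c ∈ Δ) → HGLineClosure B a c x) ∨
    (n - 1) * (ℓ - 1) ≤ 6 * ℓ * lam := by
  refine or_iff_not_imp_left.mpr fun h => ?_
  push Not at h
  obtain ⟨a, c, hax, hcx, hac, ⟨Δ, hΔ, ha, hc⟩, hacx⟩ := h
  have hcard := hP.card_le hlam hdes hss hax hcx hac hΔ ha hc hacx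
  have hlt := hP.mul_lt_card
  rw [hn] at hcard hlt
  have hℓ := hP.2.2.1
  obtain ⟨m, rfl⟩ : ∃ m, n = m + 1 := ⟨n - 1, by omega⟩
  obtain ⟨j, rfl⟩ : ∃ j, ℓ = j + 1 := ⟨ℓ - 1, by omega⟩
  simp only [Nat.add_sub_cancel]
  have hm : m ≤ 6 * lam + k := by omega
  have hmul := Nat.mul_le_mul_left (j + 1) hm
  nlinarith
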